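/- arXiv:1602.04256 — 6 statements merged into one kernel-verified Lean document; each statement's English description precedes it below -/
import Mathlib

section
/- Let X be a real-valued random variable with probability density function f supported on 𝒳 ⊆ ℝ, let ε > 0, and suppose ρ: 𝒳 → (0,∞) satisfies Equation (1): for all x, y ∈ 𝒳 with |x − y| < 2ε, |f(x) − f(y)| ≤ ρ(x) f(x) |x − y|. Let g: 𝒳 → {0,1}* and h: {0,1}* → 𝒳 satisfy the ε-closeness constraint |h(g(x)) − x| ≤ ε for all x ∈ 𝒳. Then for every x ∈ 𝒳, the set S(x) = {y ∈ 𝒳 : g(y) = g(x)} is contained in [x − 2ε, x + 2ε], and P(g(X) = g(x)) = ∫_{S(x)} f(y) dy ≤ 4ε (2ε·ρ(x) + 1) f(x). -/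
open Real MeasureTheory

/-- If `f` is a density on `𝒳 ⊆ ℝ`, `ρ` satisfies Equation (1), and `g`, `h` satisfy the
`ε`-closeness constraint, then for every `x ∈ 𝒳` the set `S(x) = {y ∈ 𝒳 : g(y) = g(x)}`
is contained in `[x − 2ε, x + 2ε]`, and
`P(g(X) = g(x)) = ∫_{S(x)} f ≤ 4ε (2ε ρ(x) + 1) f(x)`. -/
theorem level_set_probability_bound
    (𝒳 : Set ℝ) (h𝒳 : MeasurableSet 𝒳)
    (f ρ : ℝ → ℝ) (ε : ℝ) (hε : 0 < ε)
    (hf_meas : Measurable f)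
    (hf_nonneg : ∀ x ∈ 𝒳, 0 ≤ f x)
    (hf_one : ∫ x in 𝒳, f x = 1)
    (hρ_pos : ∀ x ∈ 𝒳, 0 < ρ x)
    (heq1 : ∀ x ∈ 𝒳, ∀ y ∈ 𝒳, |x - y| < 2 * ε → |f x - f y| ≤ ρ x * f x * |x - y|)
    (g : ℝ → List Bool) (h : List Bool → ℝ)
    (hclose : ∀ x ∈ 𝒳, |h (g x) - x| ≤ ε)
    (hSmeas : ∀ x ∈ 𝒳, MeasurableSet {y | y ∈ 𝒳 ∧ g y = g x}) :
    ∀ x ∈ 𝒳,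
      {y | y ∈ 𝒳 ∧ g y = g x} ⊆ Set.Icc (x - 2 * ε) (x + 2 * ε) ∧
      ∫ y in {y | y ∈ 𝒳 ∧ g y = g x}, f y ≤ 4 * ε * (2 * ε * ρ x + 1) * f x := by
  intro x hx
  have hsub : {y | y ∈ 𝒳 ∧ g y = g x} ⊆ Set.Icc (x - 2 * ε) (x + 2 * ε) := by
    rintro y ⟨hy, hgy⟩
    have h₁ := abs_le.mp (hclose x hx)
    have h₂ := abs_le.mp (hclose y hy)
    rw [hgy] at h₂
    constructor <;> linarith [h₁.1, h₁.2, h₂.1, h₂.2]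
  refine ⟨hsub, ?_⟩
  have hfx := hf_nonneg x hx
  have hρx := hρ_pos x hx
  have hbound : ∀ᵐ y, y ∈ {y | y ∈ 𝒳 ∧ g y = g x} → ‖f y‖ ≤ (2 * ε * ρ x + 1) * f x := by
    filter_upwards [Measure.ae_ne volume (x - 2 * ε), Measure.ae_ne volume (x + 2 * ε)]
      with y hleft hright hy
    have hlt : |x - y| < 2 * ε := by
      have h₁ := lt_of_le_of_ne (hsub hy).1 hleft.symm
      have h₂ := lt_of_le_of_ne (hsub hy).2 hright
      rw [abs_lt]
      constructor <;> linarith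
    have hdiff := (abs_le.mp (heq1 x hx y hy.1 hlt)).1
    have hmul : ρ x * f x * |x - y| ≤ ρ x * f x * (2 * ε) := by gcongr
    rw [Real.norm_of_nonneg (hf_nonneg y hy.1)]
    linarith
  have hvol : volume.real {y | y ∈ 𝒳 ∧ g y = g x} ≤ 4 * ε := by
    refine (measureReal_mono hsub measure_Icc_lt_top.ne).trans_eq ?_
    rw [Real.volume_real_Icc_of_le (by linarith)]
    ring
  calc ∫ y in {y | y ∈ 𝒳 ∧ g y = g x}, f y
      ≤ ‖∫ y in {y | y ∈ 𝒳 ∧ g y = g x}, f y‖ := Real.le_norm_self _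
    _ ≤ (2 * ε * ρ x + 1) * f x * volume.real {y | y ∈ 𝒳 ∧ g y = g x} :=
      norm_setIntegral_le_of_norm_le_const_ae'
        ((measure_mono hsub).trans_lt measure_Icc_lt_top) hbound
    _ ≤ (2 * ε * ρ x + 1) * f x * (4 * ε) := by gcongr
    _ = 4 * ε * (2 * ε * ρ x + 1) * f x := by ring
end

section
/- Let f be a probability density function on 𝒳 ⊆ ℝ, let ε > 0, and suppose ρ: 𝒳 → (0,∞) satisfies Equation (1): for all x, y ∈ 𝒳 with |x − y| < 2ε, |f(x) − f(y)| ≤ ρ(x) f(x) |x − y|. Let [v_l, v_r] ⊆ 𝒳 be an interval with l ≤ v_r − v_l < 2ε for some l > 0, and let x ∈ [v_l, v_r]. Then ∫_{v_l}^{v_r} f(y) dy ≥ min(l/2, 1/(4ρ(x))) · f(x). -/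
open Real MeasureTheory

/-- If `f` is a density on `𝒳 ⊆ ℝ` and `ρ` satisfies Equation (1), then for any interval
`[v_l, v_r] ⊆ 𝒳` with `l ≤ v_r − v_l < 2ε` (`l > 0`) and any `x ∈ [v_l, v_r]`,
`∫_{v_l}^{v_r} f(y) dy ≥ min(l/2, 1/(4ρ(x))) · f(x)`. -/
theorem interval_mass_lower_bound
    (𝒳 : Set ℝ) (f ρ : ℝ → ℝ) (ε l : ℝ) (hε : 0 < ε) (hl : 0 < l)
    (hf_nonneg : ∀ x ∈ 𝒳, 0 ≤ f x)
    (hf_one : ∫ x in 𝒳, f x = 1)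
    (hρ_pos : ∀ x ∈ 𝒳, 0 < ρ x)
    (heq1 : ∀ x ∈ 𝒳, ∀ y ∈ 𝒳, |x - y| < 2 * ε → |f x - f y| ≤ ρ x * f x * |x - y|)
    (vl vr x : ℝ)
    (hsub : Set.Icc vl vr ⊆ 𝒳)
    (hlen_lo : l ≤ vr - vl) (hlen_hi : vr - vl < 2 * ε)
    (hx : x ∈ Set.Icc vl vr)
    (hf_int : IntervalIntegrable f volume vl vr) :
    ∫ y in vl..vr, f y ≥ min (l / 2) (1 / (4 * ρ x)) * f x := by
  have hvx := hsub hx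
  have hρ := hρ_pos x hvx
  have hfx := hf_nonneg x hvx
  obtain ⟨hlx, hxr⟩ := hx
  set L := min l (1 / (2 * ρ x)) with hL
  have hLl : L ≤ l := min_le_left _ _
  have hL_pos : 0 < L := lt_min hl (by positivity)
  have hLρ : ρ x * L ≤ 1 / 2 := by
    calc ρ x * L ≤ ρ x * (1 / (2 * ρ x)) := by gcongr; exact min_le_right _ _
      _ = 1 / 2 := by field_simp
  have hmin : min (l / 2) (1 / (4 * ρ x)) = L / 2 := by
    rw [hL, ← min_div_div_right zero_le_two]
    congr 1
    field_simp
    norm_num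
  -- A subinterval of length `L` that still contains `x`, on which `f` is at least `f x / 2`.
  obtain ⟨p, hp, hpx, hxp, hpr⟩ : ∃ p, vl ≤ p ∧ p ≤ x ∧ x ≤ p + L ∧ p + L ≤ vr := by
    refine ⟨max vl (x - L), le_max_left _ _, max_le hlx (by linarith), ?_, ?_⟩
    · linarith [le_max_right vl (x - L)]
    · rw [← le_sub_iff_add_le]
      exact max_le (by linarith) (by linarith)
  have hhalf : ∀ y ∈ Set.Icc p (p + L), f x / 2 ≤ f y := by
    rintro y ⟨hpy, hyp⟩
    have hxy : |x - y| ≤ L := abs_le.2 ⟨by linarith, by linarith⟩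
    have hy : y ∈ 𝒳 := hsub ⟨by linarith, by linarith⟩
    have hdiff : f x - f y ≤ f x / 2 :=
      calc f x - f y ≤ ρ x * f x * |x - y| :=
            (le_abs_self _).trans (heq1 x hvx y hy (by linarith))
        _ ≤ ρ x * f x * L := by gcongr
        _ = (ρ x * L) * f x := by ring
        _ ≤ 1 / 2 * f x := by gcongr
        _ = f x / 2 := by ring
    linarith
  have hsub_int : IntervalIntegrable f volume p (p + L) :=
    hf_int.mono_set (by
      rw [Set.uIcc_of_le (by linarith), Set.uIcc_of_le (by linarith)]
      exact Set.Icc_subset_Icc hp hpr)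
  have hnonneg : 0 ≤ᵐ[volume.restrict (Set.Ioc vl vr)] f :=
    (ae_restrict_mem measurableSet_Ioc).mono fun y hy =>
      hf_nonneg y (hsub (Set.Ioc_subset_Icc_self hy))
  calc min (l / 2) (1 / (4 * ρ x)) * f x = ∫ _ in p..p + L, f x / 2 := by
        rw [hmin, intervalIntegral.integral_const, smul_eq_mul]
        ring
    _ ≤ ∫ y in p..p + L, f y :=
        intervalIntegral.integral_mono_on (by linarith) intervalIntegrable_const hsub_int hhalf
    _ ≤ ∫ y in vl..vr, f y :=
        intervalIntegral.integral_mono_interval hp (by linarith) hpr hnonneg hf_int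
end

section
/- Let f(x) = (1/(2b)) · exp(−|x − μ|/b) be the Laplace density with location μ ∈ ℝ and scale b > 0, and let ε > 0. Then the function ρ(x) = e^{2ε/b}/b satisfies Equation (1) on 𝒳 = ℝ: for all x, y ∈ ℝ with |x − y| < 2ε, |f(x) − f(y)| ≤ ρ(x) f(x) |x − y|. -/
open Real

theorem exp_sub_exp_le_exp_mul_sub (u v : ℝ) :
    Real.exp u - Real.exp v ≤ Real.exp u * (u - v) := by
  have h : Real.exp v = Real.exp u * Real.exp (v - u) := by
    rw [← Real.exp_add, add_sub_cancel]
  nlinarith [Real.exp_pos u, Real.add_one_le_exp (v - u)]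

theorem abs_exp_sub_exp_le {u v d E : ℝ} (huv : |u - v| ≤ d) (hd : d ≤ E) :
    |Real.exp u - Real.exp v| ≤ Real.exp E * Real.exp u * d := by
  have hd0 : 0 ≤ d := (abs_nonneg _).trans huv
  obtain ⟨h₁, h₂⟩ := abs_le.mp huv
  have hu : Real.exp u ≤ Real.exp E * Real.exp u := by
    rw [← Real.exp_add]
    exact Real.exp_le_exp.mpr (by linarith)
  have hv : Real.exp v ≤ Real.exp E * Real.exp u := by
    rw [← Real.exp_add]
    exact Real.exp_le_exp.mpr (by linarith)
  refine abs_sub_le_iff.mpr ⟨?_, ?_⟩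
  · calc Real.exp u - Real.exp v ≤ Real.exp u * (u - v) := exp_sub_exp_le_exp_mul_sub u v
      _ ≤ Real.exp u * d := by gcongr
      _ ≤ Real.exp E * Real.exp u * d := by gcongr
  · calc Real.exp v - Real.exp u ≤ Real.exp v * (v - u) := exp_sub_exp_le_exp_mul_sub v u
      _ ≤ Real.exp v * d := by gcongr; linarith
      _ ≤ Real.exp E * Real.exp u * d := by gcongr

/-- For the Laplace density `f(x) = (1/(2b)) exp(−|x−μ|/b)` with scale `b > 0` and any
error tolerance `ε > 0`, the function `ρ(x) = e^{2ε/b}/b` satisfies Equation (1):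
for all `x, y` with `|x − y| < 2ε`, `|f(x) − f(y)| ≤ ρ(x) f(x) |x − y|`. -/
theorem laplace_satisfies_eq1 (μ b ε : ℝ) (hb : 0 < b) (hε : 0 < ε)
    (f : ℝ → ℝ) (hf : ∀ x, f x = (1 / (2 * b)) * Real.exp (-|x - μ| / b))
    (ρ : ℝ → ℝ) (hρ : ∀ x, ρ x = Real.exp (2 * ε / b) / b) :
    ∀ x y : ℝ, |x - y| < 2 * ε → |f x - f y| ≤ ρ x * f x * |x - y| := by
  intro x y hxy
  have huv : |-|x - μ| / b - -|y - μ| / b| ≤ |x - y| / b := by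
    rw [← sub_div, abs_div, abs_of_pos hb]
    refine div_le_div_of_nonneg_right ?_ hb.le
    have h := abs_abs_sub_abs_le_abs_sub (y - μ) (x - μ)
    rwa [sub_sub_sub_cancel_right, abs_sub_comm y x, ← neg_sub_neg] at h
  have key := abs_exp_sub_exp_le huv (div_le_div_of_nonneg_right hxy.le hb.le)
  rw [hf, hf, hρ, ← mul_sub, abs_mul, abs_of_pos (by positivity : 0 < 1 / (2 * b))]
  calc _ ≤ 1 / (2 * b) *
        (Real.exp (2 * ε / b) * Real.exp (-|x - μ| / b) * (|x - y| / b)) := by gcongr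
    _ = _ := by ring
end

section
/- For all real numbers l, r with 0 ≤ l < r ≤ 1, there exist a natural number k and a natural number M with M < 2^k such that l ≤ 2^{−k}·M, 2^{−k}·(M + 1) ≤ r, and k ≤ ⌊−log₂(r − l)⌋ + 2. Consequently, the arithmetic-coding codeword of any probability interval of length p > 0 has length at most ⌊−log₂ p⌋ + 2 bits. -/
open Real

/-- An interval with more than two grid steps of size `1 / N` contains a full grid cell. -/
theorem exists_nat_grid_cell {l r N : ℝ} (hN : 0 < N) (h0 : 0 ≤ l) (h : 2 < N * (r - l)) :
    ∃ M : ℕ, l ≤ (M : ℝ) / N ∧ ((M : ℝ) + 1) / N ≤ r := by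
  refine ⟨⌈l * N⌉₊, (le_div_iff₀ hN).2 (Nat.le_ceil _), (div_le_iff₀ hN).2 ?_⟩
  have := Nat.ceil_lt_add_one (mul_nonneg h0 hN.le)
  linarith

/-- For positive `p`, the power of two with exponent `⌊-log₂ p⌋ + 2` exceeds `2 / p`. -/
theorem two_lt_two_zpow_mul {p : ℝ} (hp : 0 < p) :
    2 < (2 : ℝ) ^ (⌊-Real.logb 2 p⌋ + 2) * p := by
  have h : p⁻¹ < (2 : ℝ) ^ (⌊-Real.logb 2 p⌋ + 1) := by
    rw [← Real.rpow_intCast, ← Real.logb_lt_iff_lt_rpow one_lt_two (inv_pos.2 hp),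
      Real.logb_inv]
    push_cast
    exact Int.lt_floor_add_one _
  have h' : 1 < (2 : ℝ) ^ (⌊-Real.logb 2 p⌋ + 1) * p := (inv_lt_iff_one_lt_mul₀ hp).1 h
  rw [show ⌊-Real.logb 2 p⌋ + 2 = ⌊-Real.logb 2 p⌋ + 1 + 1 by ring,
    zpow_add_one₀ two_ne_zero]
  linarith

/-- For all reals `0 ≤ l < r ≤ 1` there exist `k M : ℕ` with `M < 2^k`,
`l ≤ M/2^k`, `(M+1)/2^k ≤ r`, and `k ≤ ⌊−log₂(r − l)⌋ + 2`.  Consequently the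
arithmetic-coding codeword of a probability interval of length `p = r − l > 0`
has at most `⌊−log₂ p⌋ + 2` bits. -/
theorem arithmetic_coding_codeword_length (l r : ℝ) (h0 : 0 ≤ l) (hlr : l < r) (h1 : r ≤ 1) :
    ∃ (k M : ℕ), M < 2 ^ k ∧
      l ≤ (M : ℝ) / 2 ^ k ∧
      ((M : ℝ) + 1) / 2 ^ k ≤ r ∧
      (k : ℤ) ≤ ⌊-Real.logb 2 (r - l)⌋ + 2 := by
  have hp : 0 < r - l := sub_pos.2 hlr
  have hlog : Real.logb 2 (r - l) ≤ 0 :=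
    Real.logb_nonpos one_lt_two hp.le (by linarith)
  obtain ⟨k, hk⟩ : ∃ k : ℕ, ⌊-Real.logb 2 (r - l)⌋ + 2 = k :=
    Int.eq_ofNat_of_zero_le (by have := Int.floor_nonneg.2 (neg_nonneg.2 hlog); omega)
  have hlt := two_lt_two_zpow_mul hp
  rw [hk, zpow_natCast] at hlt
  have hN : (0 : ℝ) < 2 ^ k := by positivity
  obtain ⟨M, hl, hr⟩ := exists_nat_grid_cell hN h0 hlt
  refine ⟨k, M, ?_, hl, hr, hk.ge⟩
  have hM : (M : ℝ) + 1 ≤ 2 ^ k := (div_le_one hN).1 (hr.trans h1)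
  exact_mod_cast hM
end

section
/- Let [l₁, r₁] and [l₂, r₂] be subintervals of [0,1] with r₁ ≤ l₂ (so their interiors are disjoint). Let k₁, M₁ and k₂, M₂ be natural numbers with [2^{−k₁}M₁, 2^{−k₁}(M₁+1)] ⊆ [l₁, r₁] and [2^{−k₂}M₂, 2^{−k₂}(M₂+1)] ⊆ [l₂, r₂]. Then the k₁-bit binary representation of M₁ is not a prefix of the k₂-bit binary representation of M₂, and vice versa; equivalently, if k₁ ≤ k₂ then ⌊M₂ / 2^{k₂−k₁}⌋ ≠ M₁, and if k₂ ≤ k₁ then ⌊M₁ / 2^{k₁−k₂}⌋ ≠ M₂. -/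
/-- The `k`-bit binary representation (most significant bit first) of a natural number `M`. -/
def kbits (k M : ℕ) : List Bool := (List.range k).map fun i => Nat.testBit M (k - 1 - i)

@[simp] lemma length_kbits (k M : ℕ) : (kbits k M).length = k := by
  simp [kbits]

lemma div_two_pow_eq_of_kbits_prefix {k M k' M' : ℕ} (hM : M < 2 ^ k) (hM' : M' < 2 ^ k')
    (h : kbits k M <+: kbits k' M') : k ≤ k' ∧ M' / 2 ^ (k' - k) = M := by
  have hk : k ≤ k' := by simpa using h.length_le
  refine ⟨hk, Nat.eq_of_testBit_eq fun j => ?_⟩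
  rw [Nat.testBit_div_two_pow]
  rcases lt_or_ge j k with hj | hj
  · have hbit := h.getElem (i := k - 1 - j) (by simp; omega)
    simp only [kbits, List.getElem_map, List.getElem_range] at hbit
    rw [show k - 1 - (k - 1 - j) = j by omega,
      show k' - 1 - (k - 1 - j) = j + (k' - k) by omega] at hbit
    exact hbit.symm
  · rw [Nat.testBit_lt_two_pow (hM.trans_le (Nat.pow_le_pow_right two_pos hj)),
      Nat.testBit_lt_two_pow (hM'.trans_le (Nat.pow_le_pow_right two_pos (by omega)))]

lemma lt_two_pow_of_add_one_div_le_one {k M : ℕ} (h : ((M : ℝ) + 1) / 2 ^ k ≤ 1) :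
    M < 2 ^ k := by
  rw [div_le_one (by positivity)] at h
  exact_mod_cast h

/-- Codewords derived from disjoint probability intervals are prefix-free:
if `[l₁,r₁]` and `[l₂,r₂]` are subintervals of `[0,1]` with `r₁ ≤ l₂`, and
`[2^{−k₁}M₁, 2^{−k₁}(M₁+1)] ⊆ [l₁,r₁]`, `[2^{−k₂}M₂, 2^{−k₂}(M₂+1)] ⊆ [l₂,r₂]`,
then neither `k`-bit binary representation is a prefix of the other; equivalently,
if `k₁ ≤ k₂` then `⌊M₂/2^{k₂−k₁}⌋ ≠ M₁` and if `k₂ ≤ k₁` then `⌊M₁/2^{k₁−k₂}⌋ ≠ M₂`. -/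
theorem disjoint_intervals_prefix_free (l₁ r₁ l₂ r₂ : ℝ)
    (h0 : 0 ≤ l₁) (hl₁r₁ : l₁ ≤ r₁) (h12 : r₁ ≤ l₂) (hl₂r₂ : l₂ ≤ r₂) (h1 : r₂ ≤ 1)
    (k₁ M₁ k₂ M₂ : ℕ)
    (h₁l : l₁ ≤ (M₁ : ℝ) / 2 ^ k₁) (h₁r : ((M₁ : ℝ) + 1) / 2 ^ k₁ ≤ r₁)
    (h₂l : l₂ ≤ (M₂ : ℝ) / 2 ^ k₂) (h₂r : ((M₂ : ℝ) + 1) / 2 ^ k₂ ≤ r₂) :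
    (¬ kbits k₁ M₁ <+: kbits k₂ M₂) ∧ (¬ kbits k₂ M₂ <+: kbits k₁ M₁) ∧
    (k₁ ≤ k₂ → M₂ / 2 ^ (k₂ - k₁) ≠ M₁) ∧ (k₂ ≤ k₁ → M₁ / 2 ^ (k₁ - k₂) ≠ M₂) := by
  have hM₁ : M₁ < 2 ^ k₁ := lt_two_pow_of_add_one_div_le_one (by linarith)
  have hM₂ : M₂ < 2 ^ k₂ := lt_two_pow_of_add_one_div_le_one (by linarith)
  have hsep : (M₁ + 1) * 2 ^ k₂ ≤ M₂ * 2 ^ k₁ := by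
    have h := h₁r.trans (h12.trans h₂l)
    rw [div_le_div_iff₀ (by positivity) (by positivity)] at h
    exact_mod_cast h
  have hdiv₁ : k₁ ≤ k₂ → M₂ / 2 ^ (k₂ - k₁) ≠ M₁ := by
    rintro hk rfl
    obtain ⟨d, rfl⟩ := Nat.exists_eq_add_of_le hk
    rw [Nat.add_sub_cancel_left, pow_add, mul_left_comm, mul_comm M₂] at hsep
    have hle := Nat.le_of_mul_le_mul_left hsep (by positivity)
    exact hle.not_gt (Nat.lt_mul_of_div_lt (Nat.lt_succ_self _) (by positivity))
  have hdiv₂ : k₂ ≤ k₁ → M₁ / 2 ^ (k₁ - k₂) ≠ M₂ := by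
    rintro hk rfl
    obtain ⟨d, rfl⟩ := Nat.exists_eq_add_of_le hk
    rw [Nat.add_sub_cancel_left, pow_add, mul_left_comm, mul_comm (M₁ + 1)] at hsep
    have hle := Nat.le_of_mul_le_mul_left hsep (by positivity)
    have := Nat.div_mul_le_self M₁ (2 ^ d)
    omega
  refine ⟨fun h => ?_, fun h => ?_, hdiv₁, hdiv₂⟩
  · obtain ⟨hk, hdiv⟩ := div_two_pow_eq_of_kbits_prefix hM₁ hM₂ h
    exact hdiv₁ hk hdiv
  · obtain ⟨hk, hdiv⟩ := div_two_pow_eq_of_kbits_prefix hM₂ hM₁ h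
    exact hdiv₂ hk hdiv
end

section
/- Let k, k′, M, M′ be natural numbers such that the dyadic interval [2^{−k′}M′, 2^{−k′}(M′+1)] is contained in the dyadic interval [2^{−k}M, 2^{−k}(M+1)]. Then k′ ≥ k and ⌊M′ / 2^{k′−k}⌋ = M; that is, the k-bit binary representation of M is a prefix of the k′-bit binary representation of M′. Consequently, if the running probability interval [L_i, R_i] in arithmetic coding satisfies 2^{−k}M ≤ L_i < R_i ≤ 2^{−k}(M+1), then the first k bits of the final codeword are the binary representation of M and may be emitted early. -/
/-- Dropping the `d` least significant bits leaves a prefix of the binary representation. -/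
lemma kbits_div_two_pow_prefix (k d M : ℕ) : kbits k (M / 2 ^ d) <+: kbits (k + d) M := by
  unfold kbits
  rw [List.range_add, List.map_append]
  refine ⟨_, congrArg (· ++ _) (List.map_congr_left fun i hi => ?_)⟩
  rw [List.mem_range] at hi
  rw [Nat.testBit_div_two_pow]
  congr 1
  omega

/-- Early bits emission: if the dyadic interval `[2^{−k′}M′, 2^{−k′}(M′+1)]` is contained in
the dyadic interval `[2^{−k}M, 2^{−k}(M+1)]`, then `k ≤ k′`, `⌊M′/2^{k′−k}⌋ = M`, and the
`k`-bit binary representation of `M` is a prefix of the `k′`-bit binary representation of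
`M′`; so once the running interval of arithmetic coding lies in `[2^{−k}M, 2^{−k}(M+1)]`,
the first `k` bits of the final codeword are the binary representation of `M`. -/
theorem dyadic_nested_prefix (k k' M M' : ℕ)
    (hsub : Set.Icc ((M' : ℝ) / 2 ^ k') (((M' : ℝ) + 1) / 2 ^ k') ⊆
      Set.Icc ((M : ℝ) / 2 ^ k) (((M : ℝ) + 1) / 2 ^ k)) :
    k ≤ k' ∧ M' / 2 ^ (k' - k) = M ∧ kbits k M <+: kbits k' M' := by
  have hle : (M' : ℝ) / 2 ^ k' ≤ ((M' : ℝ) + 1) / 2 ^ k' := by gcongr; linarith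
  obtain ⟨hlo, hhi⟩ := (Set.Icc_subset_Icc_iff hle).1 hsub
  have hk : k ≤ k' := by
    have hlen : (1 : ℝ) / 2 ^ k' ≤ 1 / 2 ^ k := by
      rw [add_div, add_div] at hhi
      linarith
    rw [one_div_le_one_div (by positivity) (by positivity)] at hlen
    exact (pow_le_pow_iff_right₀ one_lt_two).1 hlen
  obtain ⟨d, rfl⟩ := Nat.exists_eq_add_of_le hk
  rw [div_le_div_iff₀ (by positivity) (by positivity), pow_add] at hlo hhi
  have hpos : (0 : ℝ) < 2 ^ k := by positivity
  have hlo' : (M : ℝ) * 2 ^ d ≤ M' := le_of_mul_le_mul_right (by linarith) hpos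
  have hhi' : (M' : ℝ) + 1 ≤ (M + 1) * 2 ^ d := le_of_mul_le_mul_right (by linarith) hpos
  have hdiv : M' / 2 ^ d = M :=
    Nat.div_eq_of_lt_le (by exact_mod_cast hlo') (Nat.lt_of_succ_le (by exact_mod_cast hhi'))
  refine ⟨hk, by rwa [Nat.add_sub_cancel_left], ?_⟩
  simpa only [hdiv] using kbits_div_two_pow_prefix k d M'
end
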